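/- arXiv:1507.05132 — 2 statements merged into one kernel-verified Lean document; each statement's English description precedes it below -/
import Mathlib

section
/- Kato's inequality for the positive part: for f ∈ E, one has (-Δ)^{α/2}f₊(x) ≤ sgn(f₊(x))·(-Δ)^{α/2}f(x) for almost every x ∈ ℝⁿ, where f₊(x) = max(f(x), 0). -/
open MeasureTheory Filter

/-- The fractional Laplacian `(-Δ)^{α/2}` with normalizing constant `C`,
defined as the principal-value singular integral. -/
noncomputable def fracLap (n : ℕ) (α C : ℝ)
    (u : EuclideanSpace ℝ (Fin n) → ℝ) (x : EuclideanSpace ℝ (Fin n)) : ℝ :=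
  C * limUnder (nhdsWithin (0 : ℝ) (Set.Ioi 0)) (fun ε : ℝ =>
    ∫ y in {y : EuclideanSpace ℝ (Fin n) | ε ≤ dist x y},
      (u x - u y) / dist x y ^ ((n : ℝ) + α))

/-- Membership in `E = C^{1,1}_loc(ℝⁿ) ∩ L_α`. -/
def MemE (n : ℕ) (α : ℝ) (u : EuclideanSpace ℝ (Fin n) → ℝ) : Prop :=
  Differentiable ℝ u ∧
  (∀ R : ℝ, ∃ K : NNReal, LipschitzOnWith K (fderiv ℝ u) (Metric.ball 0 R)) ∧
  Integrable (fun x : EuclideanSpace ℝ (Fin n) => |u x| / (1 + ‖x‖ ^ ((n : ℝ) + α)))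

section SingularIntegral

open scoped Topology

variable {E : Type*} [NormedAddCommGroup E] [NormedSpace ℝ E] [FiniteDimensional ℝ E]
  [MeasurableSpace E] [BorelSpace E] {μ : Measure E} [μ.IsAddHaarMeasure]

omit [NormedSpace ℝ E] [FiniteDimensional ℝ E] [MeasurableSpace E] [BorelSpace E] in
lemma one_add_norm_le_mul_dist {x y : E} {ε : ℝ} (hε : 0 < ε) (h : ε ≤ dist x y) :
    1 + ‖y‖ ≤ ((1 + ‖x‖) / ε + 1) * dist x y := by
  have h1 : ‖y‖ ≤ ‖x‖ + dist x y := by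
    have := norm_sub_norm_le y x
    rw [dist_comm, dist_eq_norm]; linarith
  have h2 : 1 + ‖x‖ ≤ (1 + ‖x‖) / ε * dist x y := by
    rw [div_mul_eq_mul_div, le_div_iff₀ hε]
    gcongr
  linarith

omit [NormedSpace ℝ E] [FiniteDimensional ℝ E] in
lemma measurableSet_le_dist (x : E) (ε : ℝ) : MeasurableSet {y : E | ε ≤ dist x y} :=
  (isClosed_le continuous_const (by fun_prop)).measurableSet

/-- The singular kernel is integrable away from its pole. -/
lemma integrableOn_inv_dist_rpow {p : ℝ} (hp : (Module.finrank ℝ E : ℝ) < p) (x : E) {ε : ℝ}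
    (hε : 0 < ε) : IntegrableOn (fun y => (dist x y ^ p)⁻¹) {y | ε ≤ dist x y} μ := by
  have hp0 : 0 < p := lt_of_le_of_lt (Nat.cast_nonneg _) hp
  set M := (1 + ‖x‖) / ε + 1
  have hM : 0 < M := by positivity
  refine Integrable.mono' (((integrable_one_add_norm (μ := μ) hp).const_mul (M ^ p)).integrableOn)
    (Measurable.aestronglyMeasurable (by fun_prop)) ?_
  filter_upwards [ae_restrict_mem (measurableSet_le_dist x ε)] with y hy
  have hd : 0 < dist x y := hε.trans_le hy
  have h1 : (1 + ‖y‖) ^ p ≤ M ^ p * dist x y ^ p := by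
    rw [← Real.mul_rpow hM.le hd.le]
    exact Real.rpow_le_rpow (by positivity) (one_add_norm_le_mul_dist hε hy) hp0.le
  rw [Real.norm_of_nonneg (by positivity), Real.rpow_neg (by positivity), inv_eq_one_div,
    ← div_eq_mul_inv, div_le_div_iff₀ (by positivity) (by positivity)]
  linarith

omit [μ.IsAddHaarMeasure] in
/-- A function integrable against `(1 + ‖y‖ ^ p)⁻¹` is integrable against the singular kernel away
from its pole. -/
lemma integrableOn_div_dist_rpow {p : ℝ} (hp : 0 < p) {u : E → ℝ} (hu : Measurable u)
    (hint : Integrable (fun y => |u y| / (1 + ‖y‖ ^ p)) μ) (x : E) {ε : ℝ} (hε : 0 < ε) :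
    IntegrableOn (fun y => u y / dist x y ^ p) {y | ε ≤ dist x y} μ := by
  set M := (1 + ‖x‖) / ε + 1
  have hM : 0 < M := by positivity
  refine Integrable.mono' ((hint.const_mul (2 * M ^ p)).integrableOn)
    (Measurable.aestronglyMeasurable (by fun_prop)) ?_
  filter_upwards [ae_restrict_mem (measurableSet_le_dist x ε)] with y hy
  have hd : 0 < dist x y := hε.trans_le hy
  have h1 : (1 + ‖y‖) ^ p ≤ M ^ p * dist x y ^ p := by
    rw [← Real.mul_rpow hM.le hd.le]
    exact Real.rpow_le_rpow (by positivity) (one_add_norm_le_mul_dist hε hy) hp.le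
  have h2 : 1 ≤ (1 + ‖y‖) ^ p := Real.one_le_rpow (by linarith [norm_nonneg y]) hp.le
  have h3 : ‖y‖ ^ p ≤ (1 + ‖y‖) ^ p := by gcongr; linarith
  rw [norm_div, Real.norm_eq_abs, Real.norm_of_nonneg (by positivity : 0 ≤ dist x y ^ p),
    ← mul_div_assoc, div_le_div_iff₀ (by positivity) (by positivity)]
  calc |u y| * (1 + ‖y‖ ^ p) ≤ |u y| * (2 * (M ^ p * dist x y ^ p)) := by gcongr; linarith
    _ = _ := by ring

/-- A function vanishing to second order at `x` is integrable near `x` against the kernel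
`dist x y ^ (-p)` with `p < finrank ℝ E + 2`. -/
lemma integrableOn_ball_div_dist_rpow (hd : 1 ≤ Module.finrank ℝ E) {p : ℝ}
    (hp : p < Module.finrank ℝ E + 2) {v : E → ℝ} (hv : Measurable v) {x : E} {r K : ℝ}
    (hK0 : 0 ≤ K) (hK : ∀ y ∈ Metric.ball x r, |v y| ≤ K * ‖y - x‖ ^ 2) :
    IntegrableOn (fun y => v y / dist x y ^ p) (Metric.ball x r) μ := by
  have h0 : IntegrableOn (fun z => v (z + x) / ‖z‖ ^ p) (Metric.ball 0 r) μ := by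
    refine integrableOn_ball_of_norm_le_rpow (C := K) (α := p - 2) hd (by linarith) ?_
      (Measurable.aestronglyMeasurable (by fun_prop))
    filter_upwards [ae_restrict_mem Metric.isOpen_ball.measurableSet] with z hz
    have hz' := hK (z + x) (by simpa using hz)
    rw [add_sub_cancel_right] at hz'
    rcases eq_or_ne z 0 with rfl | hz0
    · have : v (0 + x) = 0 := by simpa using hz'
      rw [this, zero_div, norm_zero]
      positivity
    · have hn : 0 < ‖z‖ := norm_pos_iff.2 hz0
      rw [norm_div, Real.norm_eq_abs, Real.norm_of_nonneg (by positivity : 0 ≤ ‖z‖ ^ p),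
        neg_sub, Real.rpow_sub hn, ← mul_div_assoc, Real.rpow_two]
      gcongr
  rw [← integrable_indicator_iff Metric.isOpen_ball.measurableSet] at h0 ⊢
  refine (h0.comp_sub_right x).congr (.of_forall fun y => ?_)
  classical
  simp [Set.indicator_apply, dist_eq_norm, norm_sub_rev x y]

/-- Odd functions about `x` integrate to zero outside balls around `x`. -/
lemma setIntegral_le_dist_eq_zero_of_odd {g : E → ℝ} {x : E}
    (hg : ∀ y, g (x + x - y) = -g y) (ε : ℝ) : ∫ y in {y | ε ≤ dist x y}, g y ∂μ = 0 := by
  rw [← integral_indicator (measurableSet_le_dist x ε)]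
  have h := integral_sub_left_eq_self ({y | ε ≤ dist x y}.indicator g) μ (x + x)
  have h2 : ∀ y, {y | ε ≤ dist x y}.indicator g (x + x - y)
      = -({y | ε ≤ dist x y}.indicator g y) := by
    intro y
    have : dist x (x + x - y) = dist x y := by
      rw [dist_comm x y, dist_eq_norm, dist_eq_norm]; congr 1; abel
    simp only [Set.indicator_apply, Set.mem_ofPred_eq, this, hg]
    split_ifs <;> simp
  simp only [h2, integral_neg] at h
  linarith

omit [NormedSpace ℝ E] [FiniteDimensional ℝ E] [μ.IsAddHaarMeasure] in
lemma tendsto_setIntegral_le_dist {g : E → ℝ} (hg : Integrable g μ) {x : E} (hx : g x = 0) :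
    Tendsto (fun ε => ∫ y in {y | ε ≤ dist x y}, g y ∂μ) (𝓝[>] 0) (𝓝 (∫ y, g y ∂μ)) := by
  simp_rw [← integral_indicator (measurableSet_le_dist x _)]
  refine tendsto_integral_filter_of_dominated_convergence (fun y => ‖g y‖) ?_ ?_ hg.norm ?_
  · exact .of_forall fun ε =>
      (hg.indicator (measurableSet_le_dist x ε)).aestronglyMeasurable
  · exact .of_forall fun ε => .of_forall fun y => norm_indicator_le_norm_self _ _
  · refine .of_forall fun y => ?_
    rcases eq_or_ne x y with rfl | hxy
    · simp [Set.indicator_apply, hx]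
    · refine tendsto_const_nhds.congr' ?_
      filter_upwards [nhdsWithin_le_nhds (Iio_mem_nhds (dist_pos.2 hxy))] with ε hε
      exact (Set.indicator_of_mem (s := {y | ε ≤ dist x y})
        (show ε ≤ dist x y from le_of_lt hε) g).symm

lemma integrableOn_sub_div_dist_rpow {p : ℝ} (hp : (Module.finrank ℝ E : ℝ) < p) {u : E → ℝ}
    (hu : Measurable u) (hint : Integrable (fun y => |u y| / (1 + ‖y‖ ^ p)) μ) (c : ℝ) (x : E)
    {ε : ℝ} (hε : 0 < ε) :
    IntegrableOn (fun y => (c - u y) / dist x y ^ p) {y | ε ≤ dist x y} μ := by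
  simp_rw [sub_div]
  exact ((integrableOn_inv_dist_rpow hp x hε).const_mul c).sub (integrableOn_div_dist_rpow
      (lt_of_le_of_lt (Nat.cast_nonneg _) hp) hu hint x hε)

/-- The principal value integral defining the fractional Laplacian exists at every point where
the function has a first order expansion with quadratic error. -/
lemma exists_tendsto_principalValue (hd : 1 ≤ Module.finrank ℝ E) {p : ℝ}
    (hp : (Module.finrank ℝ E : ℝ) < p) (hp2 : p < Module.finrank ℝ E + 2) {u : E → ℝ}
    (hu : Measurable u) (hint : Integrable (fun y => |u y| / (1 + ‖y‖ ^ p)) μ) {x : E}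
    (L : E →L[ℝ] ℝ) {K : ℝ} (hK0 : 0 ≤ K)
    (hL : ∀ᶠ y in 𝓝 x, |u y - u x - L (y - x)| ≤ K * ‖y - x‖ ^ 2) :
    ∃ l, Tendsto (fun ε => ∫ y in {y | ε ≤ dist x y}, (u x - u y) / dist x y ^ p ∂μ)
      (𝓝[>] 0) (𝓝 l) := by
  obtain ⟨r, hr, hball⟩ := Metric.eventually_nhds_iff_ball.1 hL
  set B := Metric.ball x r
  have hB : MeasurableSet B := Metric.isOpen_ball.measurableSet
  set ℓ : E → ℝ := B.indicator fun y => L (y - x)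
  have hℓ : Measurable ℓ := Measurable.indicator (by fun_prop) hB
  set g : E → ℝ := fun y => (u x - u y + ℓ y) / dist x y ^ p
  have hℓint : ∀ ε > 0, IntegrableOn (fun y => ℓ y / dist x y ^ p) {y | ε ≤ dist x y} μ := by
    intro ε hε
    refine Integrable.mono' ((integrableOn_inv_dist_rpow hp x hε).const_mul (‖L‖ * r))
      (Measurable.aestronglyMeasurable (by fun_prop)) (.of_forall fun y => ?_)
    rw [norm_div, Real.norm_of_nonneg (by positivity : 0 ≤ dist x y ^ p), ← div_eq_mul_inv]
    gcongr
    by_cases hy : y ∈ B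
    · simp only [ℓ, Set.indicator_of_mem hy]
      refine (L.le_opNorm _).trans ?_
      gcongr
      exact (mem_ball_iff_norm.1 hy).le
    · simp only [ℓ, Set.indicator_of_notMem hy, norm_zero]
      positivity
  have hout : ∀ ε > 0, IntegrableOn g {y | ε ≤ dist x y} μ := fun ε hε => by
    simp only [g, add_div]
    exact (integrableOn_sub_div_dist_rpow hp hu hint (u x) x hε).add (hℓint ε hε)
  have hin : IntegrableOn g B μ := by
    refine integrableOn_ball_div_dist_rpow hd hp2 (by fun_prop) hK0 fun y hy => ?_
    rw [← abs_neg]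
    convert hball y hy using 2
    simp only [ℓ, Set.indicator_of_mem (show y ∈ B from hy)]
    ring
  have hg : Integrable g μ := by
    rw [← integrableOn_univ]
    refine (hin.union (hout r hr)).mono_set fun y _ => ?_
    rcases lt_or_ge (dist x y) r with h | h
    · exact Or.inl (by rwa [Metric.mem_ball, dist_comm])
    · exact Or.inr h
  refine ⟨∫ y, g y ∂μ, (tendsto_setIntegral_le_dist hg (x := x) ?_).congr' ?_⟩
  · simp [g, ℓ]
  · filter_upwards [self_mem_nhdsWithin] with ε hε
    simp only [g, add_div]
    rw [integral_add (integrableOn_sub_div_dist_rpow hp hu hint (u x) x hε) (hℓint ε hε),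
      setIntegral_le_dist_eq_zero_of_odd (g := fun y => ℓ y / dist x y ^ p), add_zero]
    intro y
    have h1 : dist x (x + x - y) = dist x y := by
      rw [dist_comm x y, dist_eq_norm, dist_eq_norm]; congr 1; abel
    have h2 : x + x - y ∈ B ↔ y ∈ B := by
      simp only [B, Metric.mem_ball']; rw [h1]
    have h3 : L (x + x - y - x) = -L (y - x) := by
      rw [← map_neg]; congr 1; abel
    by_cases hy : y ∈ B
    · simp only [ℓ, h1, Set.indicator_of_mem hy, Set.indicator_of_mem (h2.2 hy), h3, neg_div]
    · simp only [ℓ, h1, Set.indicator_of_notMem hy, Set.indicator_of_notMem (mt h2.1 hy),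
        zero_div, neg_zero]

/-- The gradient of a differentiable function vanishes almost everywhere on its zero set. -/
lemma ae_fderiv_eq_zero_of_eq_zero {f : E → ℝ} (hf : Differentiable ℝ f) :
    ∀ᵐ x ∂μ, f x = 0 → fderiv ℝ f x = 0 := by
  rcases subsingleton_or_nontrivial E with h | h
  · exact .of_forall fun x _ => Subsingleton.elim _ _
  obtain ⟨e, he⟩ := exists_ne (0 : E)
  have hs : MeasurableSet {x | f x = 0} := (isClosed_eq hf.continuous continuous_const).measurableSet
  have happ : ApproximatesLinearOn (fun x => f x • e) (0 : E →L[ℝ] E) {x | f x = 0} 0 := by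
    intro x hx y hy
    simp only [Set.mem_ofPred_eq] at hx hy
    simp [hx, hy]
  have h := happ.norm_fderiv_sub_le (μ := μ) hs (fun x => (fderiv ℝ f x).smulRight e)
    fun x _ => ((hf x).hasFDerivAt.smul_const e).hasFDerivWithinAt
  rw [ae_restrict_iff' hs] at h
  filter_upwards [h] with x hx h0
  simpa [he] using hx h0

omit [FiniteDimensional ℝ E] [MeasurableSpace E] [BorelSpace E] in
/-- Second order Taylor estimate for functions with locally Lipschitz derivative. -/
lemma eventually_abs_sub_sub_fderiv_le {f : E → ℝ} (hf : Differentiable ℝ f) {x : E} {R : ℝ}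
    (hx : x ∈ Metric.ball (0 : E) R) {K : NNReal}
    (hK : LipschitzOnWith K (fderiv ℝ f) (Metric.ball 0 R)) :
    ∀ᶠ y in 𝓝 x, |f y - f x - fderiv ℝ f x (y - x)| ≤ K * ‖y - x‖ ^ 2 := by
  obtain ⟨r, hr, hsub⟩ := Metric.isOpen_iff.1 Metric.isOpen_ball x hx
  filter_upwards [Metric.ball_mem_nhds x hr] with y hy
  have hc : ∀ z ∈ Metric.closedBall x ‖y - x‖, ‖fderiv ℝ f z - fderiv ℝ f x‖ ≤ K * ‖y - x‖ := by
    intro z hz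
    have hz' : ‖z - x‖ ≤ ‖y - x‖ := mem_closedBall_iff_norm.1 hz
    refine (hK.norm_sub_le (hsub ?_) hx).trans (by gcongr)
    exact mem_ball_iff_norm.2 (hz'.trans_lt (mem_ball_iff_norm.1 hy))
  have := (convex_closedBall x ‖y - x‖).norm_image_sub_le_of_norm_hasFDerivWithin_le'
    (fun z _ => (hf z).hasFDerivAt.hasFDerivWithinAt) hc
    (Metric.mem_closedBall_self (norm_nonneg _)) (mem_closedBall_iff_norm.2 le_rfl)
  rw [Real.norm_eq_abs] at this
  linarith

end SingularIntegral

/-- Kato's inequality for the positive part. -/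
theorem stmt2 (n : ℕ) (α C : ℝ) (hα : 0 < α) (hα2 : α < 2) (hC : 0 < C)
    (f : EuclideanSpace ℝ (Fin n) → ℝ) (hf : MemE n α f) :
    ∀ᵐ x : EuclideanSpace ℝ (Fin n),
      fracLap n α C (fun x => max (f x) 0) x
        ≤ Real.sign (max (f x) 0) * fracLap n α C f x := by
  obtain ⟨hdiff, hlip, hint⟩ := hf
  have hfin : Module.finrank ℝ (EuclideanSpace ℝ (Fin n)) = n := by simp
  have hmeas : Measurable f := hdiff.continuous.measurable
  have hmeas' : Measurable fun x => max (f x) 0 := hmeas.max measurable_const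
  have hint' : Integrable (fun x : EuclideanSpace ℝ (Fin n) =>
      |max (f x) 0| / (1 + ‖x‖ ^ ((n : ℝ) + α))) := by
    refine hint.mono' (Measurable.aestronglyMeasurable (by fun_prop))
      (.of_forall fun x => ?_)
    rw [Real.norm_of_nonneg (by positivity)]
    refine div_le_div_of_nonneg_right ?_ (by positivity)
    rw [abs_of_nonneg (le_max_right (f x) 0)]
    exact max_le (le_abs_self _) (abs_nonneg _)
  filter_upwards [ae_fderiv_eq_zero_of_eq_zero (μ := volume) hdiff] with x hx
  rcases Nat.eq_zero_or_pos n with rfl | hn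
  · have hzero : ∀ u : EuclideanSpace ℝ (Fin 0) → ℝ, fracLap 0 α C u x = 0 := by
      intro u
      have hu : ∀ y, u x - u y = 0 := fun y => by rw [Subsingleton.elim x y, sub_self]
      simp only [fracLap, hu, zero_div, integral_zero]
      rw [tendsto_const_nhds.limUnder_eq, mul_zero]
    simp [hzero]
  obtain ⟨K, hK⟩ := hlip (‖x‖ + 1)
  have htaylor := eventually_abs_sub_sub_fderiv_le hdiff (x := x) (by simp) hK
  have hexists : ∀ {u : EuclideanSpace ℝ (Fin n) → ℝ}, Measurable u →
      Integrable (fun y => |u y| / (1 + ‖y‖ ^ ((n : ℝ) + α))) →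
      ∀ L : EuclideanSpace ℝ (Fin n) →L[ℝ] ℝ,
      (∀ᶠ y in nhds x, |u y - u x - L (y - x)| ≤ K * ‖y - x‖ ^ 2) →
      ∃ l, Tendsto (fun ε => ∫ y in {y | ε ≤ dist x y},
        (u x - u y) / dist x y ^ ((n : ℝ) + α)) (nhdsWithin 0 (Set.Ioi 0)) (nhds l) :=
    fun hu hui L hL => exists_tendsto_principalValue (by rw [hfin]; exact hn)
      (by rw [hfin]; linarith) (by rw [hfin]; linarith) hu hui L K.coe_nonneg hL
  have hint_out : ∀ {u : EuclideanSpace ℝ (Fin n) → ℝ}, Measurable u →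
      Integrable (fun y => |u y| / (1 + ‖y‖ ^ ((n : ℝ) + α))) → ∀ ε > 0,
      IntegrableOn (fun y => (u x - u y) / dist x y ^ ((n : ℝ) + α)) {y | ε ≤ dist x y} :=
    fun hu hui ε hε =>
      integrableOn_sub_div_dist_rpow (by rw [hfin]; linarith) hu hui _ x hε
  rcases lt_or_ge 0 (f x) with hpos | hneg
  · obtain ⟨l, hl⟩ := hexists hmeas hint _ htaylor
    obtain ⟨l', hl'⟩ := hexists hmeas' hint' (fderiv ℝ f x) (by
      filter_upwards [htaylor, hdiff.continuous.continuousAt.eventually (lt_mem_nhds hpos)]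
        with y hy hy0
      rwa [max_eq_left hpos.le, max_eq_left hy0.le])
    have hll : l' ≤ l := by
      refine le_of_tendsto_of_tendsto hl' hl ?_
      filter_upwards [self_mem_nhdsWithin] with ε hε
      refine setIntegral_mono (hint_out hmeas' hint' ε hε) (hint_out hmeas hint ε hε) fun y => ?_
      simp only [max_eq_left hpos.le]
      gcongr
      exact le_max_left _ _
    rw [max_eq_left hpos.le, Real.sign_of_pos hpos, one_mul, fracLap, fracLap, hl.limUnder_eq,
      hl'.limUnder_eq]
    gcongr
  · obtain ⟨l', hl'⟩ := hexists hmeas' hint' 0 (by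
      rcases hneg.lt_or_eq with hlt | heq
      · filter_upwards [hdiff.continuous.continuousAt.eventually (gt_mem_nhds hlt)] with y hy
        rw [max_eq_right hlt.le, max_eq_right hy.le]
        simp
        positivity
      · filter_upwards [htaylor] with y hy
        rw [hx heq, heq] at hy
        simp only [heq, max_self, sub_zero, zero_apply] at hy ⊢
        refine le_trans ?_ hy
        rw [abs_of_nonneg (le_max_right (f y) 0)]
        exact max_le (le_abs_self _) (abs_nonneg _))
    have hll : l' ≤ 0 := by
      refine le_of_tendsto hl' (.of_forall fun ε => ?_)
      refine integral_nonpos fun y => ?_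
      simp only [max_eq_right hneg, zero_sub]
      exact div_nonpos_of_nonpos_of_nonneg (by simp) (by positivity)
    rw [max_eq_right hneg, Real.sign_zero, zero_mul, fracLap, hl'.limUnder_eq]
    exact mul_nonpos_of_nonneg_of_nonpos hC.le hll
end

section
/- Pointwise subharmonicity estimate: for u ∈ E solving (-Δ)^{α/2}u = u(1 − u²) on ℝⁿ, the inequality (-Δ)^{α/2}(u²)(x) ≤ −2u(x)²(u(x)² − 1) holds for every x ∈ ℝⁿ. -/
open MeasureTheory Filter

open scoped Topology

section FractionalLaplacian

variable {n : ℕ} {α : ℝ}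

/-- The kernel `|x - y|^{-(n+α)}` is comparable to the `L_α` weight away from `x`. -/
lemma one_add_norm_rpow_le_mul_dist_rpow {E : Type*} [NormedAddCommGroup E] {p ε : ℝ}
    (hp : 0 ≤ p) (hε : 0 < ε) {x y : E} (hxy : ε ≤ dist x y) :
    1 + ‖y‖ ^ p ≤ ((1 / ε) ^ p + (‖x‖ / ε + 1) ^ p) * dist x y ^ p := by
  have hd : 0 ≤ dist x y := dist_nonneg
  have h1 : 1 ≤ 1 / ε * dist x y := by
    rw [one_div_mul_eq_div, one_le_div hε]; exact hxy
  have hy : ‖y‖ ≤ (‖x‖ / ε + 1) * dist x y := by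
    have h2 : ‖y‖ ≤ ‖x‖ + dist x y := by
      rw [dist_eq_norm']
      simpa using norm_add_le x (y - x)
    have h3 : ‖x‖ ≤ ‖x‖ / ε * dist x y := by
      calc ‖x‖ = ‖x‖ * 1 := (mul_one _).symm
        _ ≤ ‖x‖ * (1 / ε * dist x y) := by gcongr
        _ = ‖x‖ / ε * dist x y := by ring
    linarith
  rw [add_mul, ← Real.mul_rpow (by positivity) hd, ← Real.mul_rpow (by positivity) hd]
  exact add_le_add (Real.one_le_rpow h1 hp) (Real.rpow_le_rpow (norm_nonneg _) hy hp)

lemma integrable_inv_one_add_norm_rpow (hα : 0 < α) :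
    Integrable (fun y : EuclideanSpace ℝ (Fin n) => 1 / (1 + ‖y‖ ^ ((n : ℝ) + α))) := by
  have hp : 0 ≤ (n : ℝ) + α := by positivity
  have h := (integrable_one_add_norm (E := EuclideanSpace ℝ (Fin n)) (μ := volume)
    (r := (n : ℝ) + α) (by simpa using hα)).const_mul (2 ^ ((n : ℝ) + α))
  refine h.mono' (Measurable.aestronglyMeasurable (by fun_prop)) (ae_of_all _ fun y => ?_)
  rw [Real.norm_of_nonneg (by positivity), Real.rpow_neg (by positivity), ← div_eq_mul_inv,
    div_le_div_iff₀ (by positivity) (by positivity), one_mul]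
  rcases le_total ‖y‖ 1 with hy | hy
  · calc (1 + ‖y‖) ^ ((n : ℝ) + α) ≤ 2 ^ ((n : ℝ) + α) :=
          Real.rpow_le_rpow (by positivity) (by linarith) hp
      _ ≤ _ := le_mul_of_one_le_right (by positivity) (le_add_of_nonneg_right (by positivity))
  · calc (1 + ‖y‖) ^ ((n : ℝ) + α) ≤ (2 * ‖y‖) ^ ((n : ℝ) + α) :=
          Real.rpow_le_rpow (by positivity) (by linarith) hp
      _ = 2 ^ ((n : ℝ) + α) * ‖y‖ ^ ((n : ℝ) + α) := Real.mul_rpow (by positivity) (by positivity)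
      _ ≤ _ := by gcongr; linarith

/-- The truncated singular integral converges absolutely. -/
lemma MemE.integrableOn_truncated {v : EuclideanSpace ℝ (Fin n) → ℝ} (hα : 0 < α)
    (hv : MemE n α v) (x : EuclideanSpace ℝ (Fin n)) {ε : ℝ} (hε : 0 < ε) :
    IntegrableOn (fun y => (v x - v y) / dist x y ^ ((n : ℝ) + α)) {y | ε ≤ dist x y} := by
  have hp : 0 ≤ (n : ℝ) + α := by positivity
  have hvm : Measurable v := hv.1.continuous.measurable
  set c := (1 / ε) ^ ((n : ℝ) + α) + (‖x‖ / ε + 1) ^ ((n : ℝ) + α)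
  have hint := (((integrable_inv_one_add_norm_rpow (n := n) hα).const_mul |v x|).add
    hv.2.2).const_mul c
  have hmeas : MeasurableSet {y : EuclideanSpace ℝ (Fin n) | ε ≤ dist x y} :=
    measurableSet_le measurable_const (by fun_prop)
  refine hint.integrableOn.mono' (Measurable.aestronglyMeasurable (by fun_prop)) ?_
  filter_upwards [ae_restrict_mem hmeas] with y hy
  have hd : 0 < dist x y := hε.trans_le hy
  have hle := one_add_norm_rpow_le_mul_dist_rpow hp hε hy
  rw [norm_div, Real.norm_of_nonneg (by positivity : 0 ≤ dist x y ^ ((n : ℝ) + α)),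
    Real.norm_eq_abs, div_le_iff₀ (by positivity)]
  simp only [Pi.add_apply]
  calc |v x - v y| ≤ |v x| + |v y| := abs_sub _ _
    _ = (|v x| + |v y|) / (1 + ‖y‖ ^ ((n : ℝ) + α)) * (1 + ‖y‖ ^ ((n : ℝ) + α)) := by
        field_simp
    _ ≤ (|v x| + |v y|) / (1 + ‖y‖ ^ ((n : ℝ) + α)) * (c * dist x y ^ ((n : ℝ) + α)) := by
        gcongr
    _ = _ := by ring

/-- Second differences of a `C^{1,1}_loc` function are quadratically small. -/
lemma MemE.exists_abs_second_difference_le {v : EuclideanSpace ℝ (Fin n) → ℝ}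
    (hv : MemE n α v) (x : EuclideanSpace ℝ (Fin n)) :
    ∃ K : ℝ, 0 ≤ K ∧ ∀ z ∈ Metric.ball (0 : EuclideanSpace ℝ (Fin n)) 1,
      |(v x - v (x + z)) + (v x - v (x - z))| ≤ K * ‖z‖ ^ 2 := by
  obtain ⟨K, hK⟩ := hv.2.1 (‖x‖ + 1)
  refine ⟨2 * K, by positivity, fun z hz => ?_⟩
  rw [mem_ball_zero_iff] at hz
  have key : ∀ w : EuclideanSpace ℝ (Fin n), ‖w‖ = ‖z‖ →
      |v (x + w) - v x - fderiv ℝ v x w| ≤ K * ‖z‖ ^ 2 := by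
    intro w hw
    have h := Convex.norm_image_sub_le_of_norm_fderiv_le' (𝕜 := ℝ) (f := v) (C := K * ‖z‖)
      (φ := fderiv ℝ v x) (s := Metric.closedBall x ‖z‖) (x := x) (y := x + w)
      (fun y _ => hv.1 y) ?_ (convex_closedBall _ _) (by simp) (by simp [hw])
    · simpa [hw, pow_two, mul_assoc] using h
    · intro y hy
      rw [mem_closedBall_iff_norm] at hy
      have hyb : y ∈ Metric.ball (0 : EuclideanSpace ℝ (Fin n)) (‖x‖ + 1) := by
        rw [mem_ball_zero_iff]
        have := norm_add_le x (y - x)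
        rw [add_sub_cancel] at this
        linarith
      have hxb : x ∈ Metric.ball (0 : EuclideanSpace ℝ (Fin n)) (‖x‖ + 1) := by
        rw [mem_ball_zero_iff]; linarith
      exact (hK.norm_sub_le hyb hxb).trans (by gcongr)
  have h1 := abs_le.1 (key z rfl)
  have h2 := abs_le.1 (key (-z) (norm_neg z))
  rw [map_neg, ← sub_eq_add_neg] at h2
  rw [abs_le]
  constructor <;> linarith [h1.1, h1.2, h2.1, h2.2]

/-- The symmetrized singular integral converges absolutely. -/
lemma MemE.integrable_second_difference {v : EuclideanSpace ℝ (Fin n) → ℝ} (hα : 0 < α)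
    (hα2 : α < 2) (hv : MemE n α v) (x : EuclideanSpace ℝ (Fin n)) :
    Integrable (fun z => ((v x - v (x + z)) + (v x - v (x - z))) / ‖z‖ ^ ((n : ℝ) + α)) := by
  rcases Nat.eq_zero_or_pos n with rfl | hn
  · exact Integrable.of_finite
  have hvm : Measurable v := hv.1.continuous.measurable
  obtain ⟨K, hK0, hK⟩ := hv.exists_abs_second_difference_le x
  have hball : IntegrableOn
      (fun z => ((v x - v (x + z)) + (v x - v (x - z))) / ‖z‖ ^ ((n : ℝ) + α))
      (Metric.ball 0 1) := by
    refine integrableOn_ball_of_norm_le_rpow (C := K) (α := (n : ℝ) + α - 2)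
      (by simpa using Nat.one_le_iff_ne_zero.2 hn.ne')
      (by rw [finrank_euclideanSpace_fin]; linarith) ?_
      (Measurable.aestronglyMeasurable (by fun_prop))
    filter_upwards [ae_restrict_mem Metric.isOpen_ball.measurableSet] with z hz
    rcases eq_or_ne z 0 with rfl | hz0
    · simpa using mul_nonneg hK0 (Real.rpow_nonneg le_rfl _)
    have hz1 : 0 < ‖z‖ := norm_pos_iff.2 hz0
    rw [norm_div, Real.norm_of_nonneg (by positivity : 0 ≤ ‖z‖ ^ ((n : ℝ) + α)),
      Real.norm_eq_abs, div_le_iff₀ (by positivity), mul_assoc, ← Real.rpow_add hz1]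
    have : -((n : ℝ) + α - 2) + (n + α) = (2 : ℕ) := by push_cast; ring
    rw [this, Real.rpow_natCast]
    exact hK z hz
  have hcompl : IntegrableOn
      (fun z => ((v x - v (x + z)) + (v x - v (x - z))) / ‖z‖ ^ ((n : ℝ) + α))
      (Metric.ball 0 1)ᶜ := by
    have hm : MeasurableSet {y : EuclideanSpace ℝ (Fin n) | 1 ≤ dist x y} :=
      measurableSet_le measurable_const (by fun_prop)
    have h := (integrable_indicator_iff hm).2 (hv.integrableOn_truncated hα x one_pos)
    rw [← integrable_indicator_iff Metric.isOpen_ball.measurableSet.compl]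
    refine ((h.comp_add_left x).add (h.comp_sub_left x)).congr (ae_of_all _ fun z => ?_)
    by_cases hz : 1 ≤ ‖z‖ <;> simp [Set.indicator, hz, add_div]
  simpa using hball.union hcompl

/-- The principal value defining the fractional Laplacian exists. -/
lemma MemE.tendsto_truncated {v : EuclideanSpace ℝ (Fin n) → ℝ} (hα : 0 < α)
    (hα2 : α < 2) (hv : MemE n α v) (x : EuclideanSpace ℝ (Fin n)) :
    ∃ L, Tendsto (fun ε : ℝ => ∫ y in {y : EuclideanSpace ℝ (Fin n) | ε ≤ dist x y},
      (v x - v y) / dist x y ^ ((n : ℝ) + α)) (𝓝[>] 0) (𝓝 L) := by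
  set g : EuclideanSpace ℝ (Fin n) → ℝ :=
    fun z => ((v x - v (x + z)) + (v x - v (x - z))) / ‖z‖ ^ ((n : ℝ) + α) with hg
  have hgi : Integrable g := hv.integrable_second_difference hα hα2 x
  have hm (ε : ℝ) : MeasurableSet {z : EuclideanSpace ℝ (Fin n) | ε ≤ ‖z‖} :=
    measurableSet_le measurable_const (by fun_prop)
  have hlim : Tendsto (fun ε : ℝ => ∫ z, {z | ε ≤ ‖z‖}.indicator g z) (𝓝[>] 0)
      (𝓝 (∫ z, g z)) := by
    refine tendsto_integral_filter_of_dominated_convergence (fun z => ‖g z‖)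
      (Eventually.of_forall fun ε => hgi.aestronglyMeasurable.indicator (hm ε))
      (Eventually.of_forall fun ε => ae_of_all _ fun z => norm_indicator_le_norm_self _ _)
      hgi.norm (ae_of_all _ fun z => ?_)
    rcases eq_or_ne z 0 with rfl | hz
    · have h0 : g 0 = 0 := by simp [hg]
      simp [Set.indicator, h0]
    · refine tendsto_const_nhds.congr' ?_
      filter_upwards [nhdsWithin_le_nhds (eventually_le_nhds (norm_pos_iff.2 hz))] with ε hε
      rw [Set.indicator_of_mem]
      exact hε
  refine ⟨1 / 2 * ∫ z, g z, (hlim.const_mul (1 / 2)).congr' ?_⟩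
  filter_upwards [self_mem_nhdsWithin] with ε (hε : 0 < ε)
  have hmx : MeasurableSet {y : EuclideanSpace ℝ (Fin n) | ε ≤ dist x y} :=
    measurableSet_le measurable_const (by fun_prop)
  have h := (integrable_indicator_iff hmx).2 (hv.integrableOn_truncated hα x hε)
  set F := {y : EuclideanSpace ℝ (Fin n) | ε ≤ dist x y}.indicator
    (fun y => (v x - v y) / dist x y ^ ((n : ℝ) + α)) with hF
  have hsum : {z | ε ≤ ‖z‖}.indicator g = fun z => F (x + z) + F (x - z) := by
    funext z
    by_cases hz : ε ≤ ‖z‖ <;> simp [hF, hg, Set.indicator, hz, add_div]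
  rw [hsum, integral_add (h.comp_add_left x) (h.comp_sub_left x),
    integral_add_left_eq_self, integral_sub_left_eq_self, ← integral_indicator hmx]
  ring

/-- The Córdoba–Córdoba inequality `(-Δ)^{α/2}(u²) ≤ 2u (-Δ)^{α/2}u`. -/
lemma fracLap_sq_le {C : ℝ} (hα : 0 < α) (hα2 : α < 2) (hC : 0 ≤ C)
    {u : EuclideanSpace ℝ (Fin n) → ℝ} (hu : MemE n α u)
    (hu2 : MemE n α (fun x => u x ^ 2)) (x : EuclideanSpace ℝ (Fin n)) :
    fracLap n α C (fun x => u x ^ 2) x ≤ 2 * u x * fracLap n α C u x := by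
  obtain ⟨L, hL⟩ := hu.tendsto_truncated hα hα2 x
  obtain ⟨M, hM⟩ := hu2.tendsto_truncated hα hα2 x
  have hML : M ≤ 2 * u x * L := by
    refine le_of_tendsto_of_tendsto hM (hL.const_mul (2 * u x)) ?_
    filter_upwards [self_mem_nhdsWithin] with ε (hε : 0 < ε)
    rw [← integral_const_mul]
    refine integral_mono (hu2.integrableOn_truncated hα x hε)
      ((hu.integrableOn_truncated hα x hε).const_mul _) fun y => ?_
    simp only
    rw [← mul_div_assoc]
    gcongr
    nlinarith [sq_nonneg (u x - u y)]
  rw [fracLap, fracLap, hL.limUnder_eq, hM.limUnder_eq]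
  calc C * M ≤ C * (2 * u x * L) := by gcongr
    _ = 2 * u x * (C * L) := by ring

end FractionalLaplacian

/-- Pointwise subharmonicity estimate. -/
theorem stmt15 (n : ℕ) (α C : ℝ) (hα : 0 < α) (hα2 : α < 2) (hC : 0 < C)
    (u : EuclideanSpace ℝ (Fin n) → ℝ) (hu : MemE n α u)
    (hu2 : MemE n α (fun x => u x ^ 2))
    (heq : ∀ x, fracLap n α C u x = u x * (1 - u x ^ 2)) :
    ∀ x, fracLap n α C (fun x => u x ^ 2) x ≤ -2 * u x ^ 2 * (u x ^ 2 - 1) := by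
  intro x
  have h := fracLap_sq_le hα hα2 hC.le hu hu2 x
  rw [heq] at h
  linarith
end
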